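/- Let X₁,…,Xₙ be m×m complex matrices satisfying [Xᵢ,Xⱼ] = 0 for all i,j and Σᵢ [Xᵢ†,Xᵢ] = 0. Then there exists a unitary matrix U such that U Xᵢ U⁻¹ is diagonal for every i (the Xᵢ are simultaneously unitarily diagonalizable). -/

import Mathlib

open scoped BigOperators Matrix

/-- Trace identity behind the vanishing of `[A, Bᴴ]`. -/
lemma trace_comm_identity {m : ℕ} (A B : Matrix (Fin m) (Fin m) ℂ) (h : A * B = B * A) :
    ((A * Bᴴ - Bᴴ * A)ᴴ * (A * Bᴴ - Bᴴ * A)).trace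
      = ((Bᴴ * B - B * Bᴴ) * (Aᴴ * A - A * Aᴴ)).trace := by
  have h' : Aᴴ * Bᴴ = Bᴴ * Aᴴ := by
    rw [← Matrix.conjTranspose_mul, ← Matrix.conjTranspose_mul, h]
  have e1 : (B * Aᴴ * (A * Bᴴ)).trace = (Bᴴ * B * (Aᴴ * A)).trace := by
    rw [← Matrix.mul_assoc, Matrix.trace_mul_comm]
    simp only [Matrix.mul_assoc]
  have e2 : (B * Aᴴ * (Bᴴ * A)).trace = (Bᴴ * B * (A * Aᴴ)).trace := by
    have : Bᴴ * B * (A * Aᴴ) = (Bᴴ * A) * (B * Aᴴ) := by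
      calc _ = Bᴴ * (B * A) * Aᴴ := by simp only [Matrix.mul_assoc]
        _ = _ := by rw [← h]; simp only [Matrix.mul_assoc]
    rw [this, Matrix.trace_mul_comm]
  have e3 : (Aᴴ * B * (A * Bᴴ)).trace = (B * Bᴴ * (Aᴴ * A)).trace := by
    rw [Matrix.trace_mul_comm (B * Bᴴ)]
    congr 1
    calc _ = Aᴴ * (B * A) * Bᴴ := by simp only [Matrix.mul_assoc]
      _ = _ := by rw [← h]; simp only [Matrix.mul_assoc]
  have e4 : (Aᴴ * B * (Bᴴ * A)).trace = (B * Bᴴ * (A * Aᴴ)).trace := by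
    rw [Matrix.mul_assoc, Matrix.trace_mul_comm]
    simp only [Matrix.mul_assoc]
  simp only [Matrix.conjTranspose_sub, Matrix.conjTranspose_mul,
    Matrix.conjTranspose_conjTranspose, sub_mul, mul_sub, Matrix.trace_sub, e1, e2, e3, e4]

lemma comm_star {n m : ℕ} (X : Fin n → Matrix (Fin m) (Fin m) ℂ)
    (hcomm : ∀ i j, X i * X j = X j * X i)
    (hD : ∑ i, ((X i)ᴴ * X i - X i * (X i)ᴴ) = 0) (i j : Fin n) :
    X i * (X j)ᴴ = (X j)ᴴ * X i := by
  open ComplexOrder in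
  have hs : ∑ i, ((X i * (X j)ᴴ - (X j)ᴴ * X i)ᴴ * (X i * (X j)ᴴ - (X j)ᴴ * X i)).trace = 0 := by
    simp_rw [fun i => trace_comm_identity (X i) (X j) (hcomm i j)]
    rw [← Matrix.trace_sum, ← Matrix.mul_sum, hD, mul_zero, Matrix.trace_zero]
  rw [Finset.sum_eq_zero_iff_of_nonneg
    (fun i _ => (Matrix.posSemidef_conjTranspose_mul_self _).trace_nonneg)] at hs
  exact sub_eq_zero.1 (Matrix.trace_conjTranspose_mul_self_eq_zero_iff.1 (hs i (Finset.mem_univ _)))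

/-- Commuting Hermitian families have a joint orthonormal eigenbasis. -/
lemma exists_joint_basis {ι : Type} [Fintype ι] {m : ℕ} (H : ι → Matrix (Fin m) (Fin m) ℂ)
    (hH : ∀ i, (H i).IsHermitian) (hc : ∀ i j, H i * H j = H j * H i) :
    ∃ (b : OrthonormalBasis (Fin m) ℂ (EuclideanSpace ℂ (Fin m))) (c : Fin m → ι → ℂ),
      ∀ k i, H i *ᵥ (b k).ofLp = c k i • (b k).ofLp := by
  classical
  have hT : ∀ i, (Matrix.toEuclideanLin (H i)).IsSymmetric := fun i =>
    Matrix.isSymmetric_toEuclideanLin_iff.2 (hH i)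
  have hC : Pairwise (Function.onFun Commute (fun i => Matrix.toEuclideanLin (H i))) := by
    intro i j _
    change _ * _ = _ * _
    ext1 v
    simp [Matrix.toLpLin_apply, hc i j]
  have hI := LinearMap.IsSymmetric.directSum_isInternal_of_pairwise_commute hT hC
  have hO := LinearMap.IsSymmetric.orthogonalFamily_iInf_eigenspaces hT
  have hfin := Submodule.finite_ne_bot_of_iSupIndep hI.submodule_iSupIndep
  have hI' := DirectSum.isInternal_ne_bot_iff.2 hI
  let _ : Fintype {γ : ι → ℂ //
    (⨅ j, Module.End.eigenspace (Matrix.toEuclideanLin (H j)) (γ j)) ≠ ⊥} := hfin.fintype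
  have hO' := hO.comp (f := fun γ : {γ : ι → ℂ //
    (⨅ j, Module.End.eigenspace (Matrix.toEuclideanLin (H j)) (γ j)) ≠ ⊥} => γ.1)
    Subtype.val_injective
  have hn : Module.finrank ℂ (EuclideanSpace ℂ (Fin m)) = m := by simp
  refine ⟨hI'.subordinateOrthonormalBasis hn hO',
    fun k => (hI'.subordinateOrthonormalBasisIndex hn k hO').1, fun k i => ?_⟩
  have h := hI'.subordinateOrthonormalBasis_subordinate hn k hO'
  have h2 := Module.End.mem_eigenspace_iff.1 ((Submodule.mem_iInf _).1 h i)
  have h3 := congrArg WithLp.ofLp h2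
  simpa [Matrix.toLpLin_apply] using h3

/-- If `X₁,…,Xₙ` are pairwise commuting `m×m` complex matrices with
`Σᵢ [Xᵢᴴ, Xᵢ] = 0`, then the `Xᵢ` are simultaneously unitarily diagonalizable: there is a
unitary `U` with `U * Xᵢ * U⁻¹` diagonal for every `i`. -/
theorem commuting_zero_moment_map_simultaneously_diagonalizable {n m : ℕ}
    (X : Fin n → Matrix (Fin m) (Fin m) ℂ)
    (hcomm : ∀ i j, X i * X j = X j * X i)
    (hD : ∑ i, ((X i)ᴴ * X i - X i * (X i)ᴴ) = 0) :
    ∃ U : Matrix.unitaryGroup (Fin m) ℂ,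
      ∀ i, ((U : Matrix (Fin m) (Fin m) ℂ) * X i * (U⁻¹ : Matrix.unitaryGroup (Fin m) ℂ)).IsDiag := by
  have hs := comm_star X hcomm hD
  have hss : ∀ i j, (X i)ᴴ * (X j)ᴴ = (X j)ᴴ * (X i)ᴴ := fun i j => by
    rw [← Matrix.conjTranspose_mul, ← Matrix.conjTranspose_mul, hcomm]
  let H : Fin n ⊕ Fin n → Matrix (Fin m) (Fin m) ℂ :=
    Sum.elim (fun i => X i + (X i)ᴴ) (fun i => Complex.I • (X i - (X i)ᴴ))
  obtain ⟨b, c, hb⟩ := exists_joint_basis H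
    (by
      rintro (i | i)
      · simp [H, Matrix.IsHermitian, add_comm]
      · simp [H, Matrix.IsHermitian, ← smul_neg])
    (by
      rintro (i | i) (j | j) <;>
      simp only [H, Sum.elim_inl, Sum.elim_inr, smul_mul_assoc, mul_smul_comm, add_mul, mul_add,
        sub_mul, mul_sub, hcomm i j, hs i j, hss i j, ← hs j i] <;>
      module)
  have hX : ∀ k i, X i *ᵥ (b k).ofLp
      = ((c k (Sum.inl i) - Complex.I * c k (Sum.inr i)) / 2) • (b k).ofLp := by
    intro k i
    have h1 := hb k (Sum.inl i)
    have h2 := hb k (Sum.inr i)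
    have e : X i = (1 / 2 : ℂ) • (H (Sum.inl i) - Complex.I • H (Sum.inr i)) := by
      simp only [H, Sum.elim_inl, Sum.elim_inr, smul_smul, Complex.I_mul_I]
      module
    rw [e, Matrix.smul_mulVec, Matrix.sub_mulVec, Matrix.smul_mulVec, h1, h2]
    module
  let V := (EuclideanSpace.basisFun (Fin m) ℂ).toBasis.toMatrix b
  have hV : V ∈ Matrix.unitaryGroup (Fin m) ℂ :=
    (EuclideanSpace.basisFun (Fin m) ℂ).toMatrix_orthonormalBasis_mem_unitary b
  have hVe : ∀ p k, V p k = (b k).ofLp p := fun p k => by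
    simp [V, Module.Basis.toMatrix_apply]
  refine ⟨(⟨V, hV⟩ : Matrix.unitaryGroup (Fin m) ℂ)⁻¹, fun i => ?_⟩
  have hXV : X i * V = V * Matrix.diagonal
      (fun k => (c k (Sum.inl i) - Complex.I * c k (Sum.inr i)) / 2) := by
    ext p k
    have := congrFun (hX k i) p
    rw [Matrix.mul_diagonal, Matrix.mul_apply]
    simp only [hVe]
    rw [mul_comm]
    exact this
  have hVV : star V * V = 1 := Matrix.mem_unitaryGroup_iff'.1 hV
  rw [inv_inv]
  change (star V * X i * V).IsDiag
  rw [Matrix.mul_assoc, hXV, ← Matrix.mul_assoc, hVV, one_mul]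
  exact Matrix.isDiag_diagonal _
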